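/- Let d ∈ ℕ with d ≥ 1, n ∈ [2,3], and c ∈ [1.55, n). Then (−∞, μ₃(Q₃)) ⊆ A, where Q₃ ∈ (Q_*, 1) is the unique global minimizer of μ₃ on (Q_*, 1). -/

import Mathlib

open Set Filter Topology intervalIntegral Real

noncomputable section

/-- The rescaled traveling-wave ODE for the magma equation at a point `r`. -/
def magmaODE (d n c : ℝ) (Q : ℝ → ℝ) (r : ℝ) : Prop :=
  -deriv Q r + (1 / c) * deriv (fun s => Q s ^ n) r
    + deriv (fun s => Q s ^ n * deriv (deriv Q) s) r
    + (d - 1) * Q r ^ n * deriv (fun s => deriv Q s / s) r = 0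

/-- Solution of the IVP on `[0, σ]`. -/
def isIVPSolutionOn (d n c μ : ℝ) (Q : ℝ → ℝ) (σ : ℝ) : Prop :=
  ContDiffOn ℝ 3 Q (Icc 0 σ) ∧ (∀ r ∈ Ioo (0:ℝ) σ, magmaODE d n c Q r) ∧
    Q 0 = 1 ∧ deriv Q 0 = 0 ∧ deriv (deriv Q) 0 = μ

/-- Solution of the IVP on `[0, ∞)`. -/
def isIVPSolution (d n c μ : ℝ) (Q : ℝ → ℝ) : Prop :=
  ContDiffOn ℝ 3 Q (Ici 0) ∧ (∀ r : ℝ, 0 < r → magmaODE d n c Q r) ∧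
    Q 0 = 1 ∧ deriv Q 0 = 0 ∧ deriv (deriv Q) 0 = μ

def F1 (d n c : ℝ) (Q μ : ℝ) : ℝ :=
  -(1 / (n - 1)) * (Q ^ (1 - n) - 1) - (n / c) * Real.log Q + μ * d

def F2 (d n c : ℝ) (Q μ : ℝ) : ℝ :=
  ∫ q in (1:ℝ)..Q, F1 d n c q μ * q ^ n

def F3 (d n c : ℝ) (Q μ : ℝ) : ℝ :=
  F1 d n c Q μ - n * ∫ q in (1:ℝ)..Q, F2 d n c q μ * q ^ (-(n + 2))

def mu1 (d n c Q : ℝ) : ℝ := -(F1 d n c Q 0) / (F1 d n c Q 1 - F1 d n c Q 0)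
def mu2 (d n c Q : ℝ) : ℝ := -(F2 d n c Q 0) / (F2 d n c Q 1 - F2 d n c Q 0)
def mu3 (d n c Q : ℝ) : ℝ := -(F3 d n c Q 0) / (F3 d n c Q 1 - F3 d n c Q 0)

def h3ex (d n Q : ℝ) : ℝ :=
  d * (1 - n * Real.log Q / (n + 1) - n / (n + 1) ^ 2 * (Q ^ (-(n + 1)) - 1))

def setA (d n c Qs : ℝ) : Set ℝ :=
  {μ : ℝ | μ < 0 ∧ ∃ (Q : ℝ → ℝ) (σ rs : ℝ), 0 < rs ∧ rs < σ ∧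
    isIVPSolutionOn d n c μ Q σ ∧ (∀ r ∈ Ioc (0:ℝ) σ, 0 < Q r ∧ deriv Q r < 0) ∧
    Q rs = Qs}

theorem mul_integral_exp_mul {K : ℝ} (hK : 0 < K) (a : ℝ) :
    a * ∫ t in (0:ℝ)..1, Real.exp (K * (a * t)) = (Real.exp (K * a) - 1) / K := by
  have h : ∀ t ∈ uIcc (0:ℝ) 1,
      HasDerivAt (fun t => Real.exp (K * (a * t)) / K) (a * Real.exp (K * (a * t))) t := by
    intro t _
    have h1 : HasDerivAt (fun t : ℝ => K * (a * t)) (K * (a * 1)) t :=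
      ((hasDerivAt_id t).const_mul a).const_mul K
    refine (h1.exp.div_const K).congr_deriv ?_
    field_simp
  rw [← intervalIntegral.integral_const_mul, intervalIntegral.integral_eq_sub_of_hasDerivAt h
    (by apply Continuous.intervalIntegrable; fun_prop)]
  simp
  ring

/-- A Volterra equation with Lipschitz nonlinearity has a global solution. -/
theorem exists_continuous_volterra {E : Type*} [NormedAddCommGroup E] [NormedSpace ℝ E]
    [CompleteSpace E] (H : ℝ → E → E) (hH : Continuous (Function.uncurry H)) {L : ℝ} (hL0 : 0 ≤ L)
    (hL : ∀ t ∈ Icc (0:ℝ) 1, ∀ x y, ‖H t x - H t y‖ ≤ L * ‖x - y‖) (x₀ : E) :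
    ∃ X : ℝ → E, Continuous X ∧ ∀ r, X r = x₀ + r • ∫ t in (0:ℝ)..1, H t (X (r * t)) := by
  set K : ℝ := 2 * L + 1 with hKdef
  have hK : 0 < K := by positivity
  have hLK : L / K ≤ 1 / 2 := by rw [div_le_div_iff₀ hK (by norm_num)]; linarith
  have hLK0 : 0 ≤ L / K := by positivity
  let e : ℝ → ℝ := fun r => Real.exp (K * |r|)
  have he : Continuous e := by fun_prop
  have hepos : ∀ r, 0 < e r := fun r => Real.exp_pos _
  let S : (ℝ → E) → ℝ → E := fun X r => x₀ + r • ∫ t in (0:ℝ)..1, H t (X (r * t))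
  have hHX : ∀ X : ℝ → E, Continuous X → Continuous (fun q : ℝ × ℝ => H q.2 (X (q.1 * q.2))) :=
    fun X hX => hH.comp (by fun_prop : Continuous fun q : ℝ × ℝ => (q.2, X (q.1 * q.2)))
  have hSc : ∀ X, Continuous X → Continuous (S X) := by
    intro X hX
    have := intervalIntegral.continuous_parametric_intervalIntegral_of_continuous'
      (μ := MeasureTheory.volume) (f := fun r t => H t (X (r * t))) (hHX X hX) 0 1
    exact continuous_const.add (continuous_id.smul this)
  have hHi : ∀ X : ℝ → E, Continuous X → ∀ r, Continuous (fun t => H t (X (r * t))) :=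
    fun X hX r => (hHX X hX).comp (by fun_prop : Continuous fun t : ℝ => (r, t))
  have habs : ∀ r t : ℝ, t ∈ Icc (0:ℝ) 1 → e (r * t) = Real.exp (K * (|r| * t)) := by
    intro r t ht
    simp only [e, abs_mul, abs_of_nonneg ht.1]
  have key : ∀ X Y : ℝ → E, Continuous X → Continuous Y → ∀ C, 0 ≤ C →
      (∀ r, ‖X r - Y r‖ ≤ C * e r) → ∀ r, ‖S X r - S Y r‖ ≤ (L / K) * C * e r := by
    intro X Y hX hY C hC hXY r
    have h1 : S X r - S Y r =
        r • ∫ t in (0:ℝ)..1, (H t (X (r * t)) - H t (Y (r * t))) := by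
      rw [intervalIntegral.integral_sub ((hHi X hX r).intervalIntegrable _ _)
        ((hHi Y hY r).intervalIntegrable _ _), smul_sub]
      simp only [S]; abel
    have h2 : ‖∫ t in (0:ℝ)..1, (H t (X (r * t)) - H t (Y (r * t)))‖ ≤
        ∫ t in (0:ℝ)..1, L * C * Real.exp (K * (|r| * t)) := by
      apply intervalIntegral.norm_integral_le_of_norm_le zero_le_one
      · refine Eventually.of_forall fun t ht => ?_
        have ht' : t ∈ Icc (0:ℝ) 1 := ⟨ht.1.le, ht.2⟩
        refine (hL t ht' _ _).trans ?_
        rw [mul_assoc, ← habs r t ht']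
        exact mul_le_mul_of_nonneg_left (hXY _) hL0
      · apply Continuous.intervalIntegrable; fun_prop
    rw [h1, norm_smul, Real.norm_eq_abs]
    calc |r| * ‖∫ t in (0:ℝ)..1, (H t (X (r * t)) - H t (Y (r * t)))‖
        ≤ |r| * ∫ t in (0:ℝ)..1, L * C * Real.exp (K * (|r| * t)) :=
          mul_le_mul_of_nonneg_left h2 (abs_nonneg r)
      _ = L * C * ((Real.exp (K * |r|) - 1) / K) := by
          rw [intervalIntegral.integral_const_mul, ← mul_integral_exp_mul hK]; ring
      _ ≤ L * C * (Real.exp (K * |r|) / K) := by gcongr; linarith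
      _ = (L / K) * C * e r := by simp only [e]; ring
  obtain ⟨M, hM⟩ : ∃ M, ∀ t ∈ Icc (0:ℝ) 1, ‖H t 0‖ ≤ M := by
    have hc : Continuous fun t => H t 0 :=
      hH.comp (by fun_prop : Continuous fun t : ℝ => (t, (0:E)))
    exact isCompact_Icc.exists_bound_of_continuousOn hc.continuousOn
  have hM0 : 0 ≤ M := (norm_nonneg _).trans (hM 0 ⟨le_rfl, zero_le_one⟩)
  have hS0 : ∀ r, ‖S (fun _ => 0) r‖ ≤ (‖x₀‖ + M / K) * e r := by
    intro r
    have h2 : ‖∫ t in (0:ℝ)..1, H t 0‖ ≤ M := by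
      have := intervalIntegral.norm_integral_le_of_norm_le_const (a := (0:ℝ)) (b := 1)
        (f := fun t => H t 0) (C := M) (fun t ht => by
          rw [uIoc_of_le zero_le_one] at ht
          exact hM t ⟨ht.1.le, ht.2⟩)
      simpa using this
    have h3 : K * |r| + 1 ≤ e r := Real.add_one_le_exp _
    have h4 : 0 ≤ K * |r| := by positivity
    calc ‖S (fun _ => 0) r‖ ≤ ‖x₀‖ + |r| * ‖∫ t in (0:ℝ)..1, H t 0‖ := by
          refine (norm_add_le _ _).trans ?_
          rw [norm_smul, Real.norm_eq_abs]
      _ ≤ ‖x₀‖ * 1 + |r| * M := by rw [mul_one]; gcongr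
      _ = ‖x₀‖ * 1 + M / K * (K * |r|) := by field_simp
      _ ≤ ‖x₀‖ * e r + M / K * e r := by gcongr <;> linarith
      _ = _ := by ring
  let wt : (BoundedContinuousFunction ℝ E) → ℝ → E := fun y r => e r • y r
  have hwt : ∀ y, Continuous (wt y) := fun y => he.smul y.continuous
  have hbd : ∀ y : BoundedContinuousFunction ℝ E, ∀ r,
      ‖(e r)⁻¹ • S (wt y) r‖ ≤ ‖x₀‖ + M / K + L / K * ‖y‖ := by
    intro y r
    have h1 := key (wt y) (fun _ => 0) (hwt y) continuous_const ‖y‖ (norm_nonneg _) (by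
      intro r
      simp only [wt, sub_zero, norm_smul, Real.norm_eq_abs, abs_of_pos (hepos r)]
      rw [mul_comm]
      exact mul_le_mul_of_nonneg_right (y.norm_coe_le_norm r) (hepos r).le) r
    have h2 : ‖S (wt y) r‖ ≤ (‖x₀‖ + M / K + L / K * ‖y‖) * e r := by
      have := norm_le_norm_add_norm_sub' (S (wt y) r) (S (fun _ => 0) r)
      linarith [hS0 r]
    rw [norm_smul, norm_inv, Real.norm_eq_abs, abs_of_pos (hepos r), inv_mul_le_iff₀ (hepos r)]
    linarith
  let T : BoundedContinuousFunction ℝ E → BoundedContinuousFunction ℝ E := fun y =>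
    BoundedContinuousFunction.ofNormedAddCommGroup (fun r => (e r)⁻¹ • S (wt y) r)
      ((he.inv₀ fun r => (hepos r).ne').smul (hSc _ (hwt y))) _ (hbd y)
  have hT : ContractingWith (1 / 2) T := by
    refine ⟨by rw [← NNReal.coe_lt_coe]; norm_num, LipschitzWith.of_dist_le_mul fun y z => ?_⟩
    rw [BoundedContinuousFunction.dist_le (by positivity)]
    intro r
    have h1 := key (wt y) (wt z) (hwt y) (hwt z) (dist y z) dist_nonneg (by
      intro r
      simp only [wt, ← smul_sub, norm_smul, Real.norm_eq_abs, abs_of_pos (hepos r)]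
      rw [mul_comm, ← dist_eq_norm]
      exact mul_le_mul_of_nonneg_right (BoundedContinuousFunction.dist_coe_le_dist r)
        (hepos r).le) r
    have h2 : dist (T y r) (T z r) = (e r)⁻¹ * ‖S (wt y) r - S (wt z) r‖ := by
      simp only [T, BoundedContinuousFunction.coe_ofNormedAddCommGroup]
      rw [dist_eq_norm, ← smul_sub, norm_smul, norm_inv, Real.norm_eq_abs, abs_of_pos (hepos r)]
    rw [h2, inv_mul_le_iff₀ (hepos r)]
    refine h1.trans ?_
    rw [mul_comm]
    have : L / K * dist y z ≤ 1 / 2 * dist y z := by gcongr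
    have := mul_le_mul_of_nonneg_left this (hepos r).le
    simpa using this
  obtain ⟨y, hy⟩ : ∃ y, T y = y := ⟨_, hT.fixedPoint_isFixedPt⟩
  refine ⟨wt y, hwt y, fun r => ?_⟩
  have h1 : (e r)⁻¹ • S (wt y) r = y r := by
    conv_rhs => rw [← hy]
    rfl
  change e r • y r = S (wt y) r
  rw [← h1, smul_inv_smul₀ (hepos r).ne']

/-- The weighted average `∫₀¹ tᵏ g(r t) dt`. -/
def radialAvg (k : ℕ) (g : ℝ → ℝ) (r : ℝ) : ℝ := ∫ t in (0:ℝ)..1, t ^ k * g (r * t)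

theorem continuous_radialAvg (k : ℕ) {g : ℝ → ℝ} (hg : Continuous g) :
    Continuous (radialAvg k g) :=
  intervalIntegral.continuous_parametric_intervalIntegral_of_continuous'
    (f := fun r t => t ^ k * g (r * t)) (by unfold Function.uncurry; fun_prop) 0 1

theorem radialAvg_const (k : ℕ) (a r : ℝ) : radialAvg k (fun _ => a) r = a / (k + 1) := by
  simp [radialAvg, integral_pow]
  ring

theorem radialAvg_zero (k : ℕ) (g : ℝ → ℝ) : radialAvg k g 0 = g 0 / (k + 1) := by
  rw [← radialAvg_const k (g 0) 0]
  simp [radialAvg]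

theorem pow_mul_radialAvg (k : ℕ) (g : ℝ → ℝ) (r : ℝ) :
    r ^ (k + 1) * radialAvg k g r = ∫ s in (0:ℝ)..r, s ^ k * g s := by
  have h := intervalIntegral.mul_integral_comp_mul_left (a := 0) (b := 1)
    (f := fun s => s ^ k * g s) r
  rw [mul_zero, mul_one] at h
  rw [← h, radialAvg, pow_succ', mul_assoc, ← intervalIntegral.integral_const_mul]
  congr 2
  ext t
  ring

theorem hasDerivAt_radialAvg (k : ℕ) {g : ℝ → ℝ} (hg : Continuous g) {r : ℝ} (hr : r ≠ 0) :
    HasDerivAt (radialAvg k g) ((g r - (k + 1) * radialAvg k g r) / r) r := by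
  have hc : Continuous fun s : ℝ => s ^ k * g s := by fun_prop
  have h1 : HasDerivAt (fun u => ∫ s in (0:ℝ)..u, s ^ k * g s) (r ^ k * g r) r :=
    hc.integral_hasStrictDerivAt 0 r |>.hasDerivAt
  have h2 := h1.div (hasDerivAt_pow (k + 1) r) (pow_ne_zero _ hr)
  have h3 : radialAvg k g =ᶠ[𝓝 r] fun u => (∫ s in (0:ℝ)..u, s ^ k * g s) / u ^ (k + 1) := by
    filter_upwards [isOpen_ne.mem_nhds hr] with u hu
    rw [← pow_mul_radialAvg, mul_div_cancel_left₀ _ (pow_ne_zero _ hu)]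
  refine (h2.congr_of_eventuallyEq h3).congr_deriv ?_
  rw [← pow_mul_radialAvg]
  have := pow_ne_zero k hr
  push_cast
  field_simp
  ring

theorem hasDerivAt_radialAvg_zero (k : ℕ) {g : ℝ → ℝ} (hg : Continuous g)
    (h0 : HasDerivAt g 0 0) : HasDerivAt (radialAvg k g) 0 0 := by
  rw [hasDerivAt_iff_isLittleO] at h0 ⊢
  rw [Asymptotics.isLittleO_iff] at h0 ⊢
  intro c hc
  obtain ⟨δ, hδ, h⟩ := Metric.eventually_nhds_iff.1 (h0 hc)
  refine Metric.eventually_nhds_iff.2 ⟨δ, hδ, fun r hr => ?_⟩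
  have h1 : radialAvg k g r - radialAvg k g 0 =
      ∫ t in (0:ℝ)..1, t ^ k * (g (r * t) - g 0) := by
    unfold radialAvg
    rw [← intervalIntegral.integral_sub]
    · congr 1; ext t; rw [zero_mul]; ring
    all_goals apply Continuous.intervalIntegrable; fun_prop
  simp only [smul_zero, sub_zero] at h ⊢
  rw [h1]
  have h2 := intervalIntegral.norm_integral_le_of_norm_le_const (a := (0:ℝ)) (b := 1)
    (f := fun t => t ^ k * (g (r * t) - g 0)) (C := c * ‖r‖) (fun t ht => by
      rw [uIoc_of_le zero_le_one] at ht
      have hrt : ‖r * t‖ ≤ ‖r‖ := by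
        rw [norm_mul, Real.norm_of_nonneg ht.1.le]
        exact mul_le_of_le_one_right (norm_nonneg _) ht.2
      have h3 : ‖g (r * t) - g 0‖ ≤ c * ‖r * t‖ := by
        apply h
        rw [dist_zero_right] at hr ⊢
        exact hrt.trans_lt hr
      rw [norm_mul]
      have h4 : ‖t ^ k‖ ≤ 1 := by
        rw [norm_pow, Real.norm_of_nonneg ht.1.le]
        exact pow_le_one₀ ht.1.le ht.2
      calc ‖t ^ k‖ * ‖g (r * t) - g 0‖ ≤ 1 * (c * ‖r * t‖) := by gcongr
        _ ≤ c * ‖r‖ := by rw [one_mul]; gcongr)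
  simpa using h2

theorem hasDerivAt_mul_radialAvg (k : ℕ) {g : ℝ → ℝ} (hg : Continuous g) (r : ℝ) :
    HasDerivAt (fun r => r * radialAvg k g r) (g r - k * radialAvg k g r) r := by
  by_cases hr : r = 0
  · subst hr
    have h : HasDerivAt (fun r => r * radialAvg k g r) (radialAvg k g 0) 0 := by
      rw [hasDerivAt_iff_tendsto_slope]
      refine (((continuous_radialAvg k hg).tendsto 0).mono_left nhdsWithin_le_nhds).congr' ?_
      filter_upwards [self_mem_nhdsWithin] with u hu
      have hu : u ≠ 0 := hu
      simp [slope_def_field, hu]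
    refine h.congr_deriv ?_
    rw [radialAvg_zero]
    have : (k:ℝ) + 1 ≠ 0 := by positivity
    field_simp
    ring
  · refine ((hasDerivAt_id r).mul (hasDerivAt_radialAvg k hg hr)).congr_deriv ?_
    simp only [id]
    field_simp
    ring

theorem radialAvg_neg (k : ℕ) {g : ℝ → ℝ} (hg : Continuous g) {r : ℝ} (hr : 0 < r)
    (h : ∀ s ∈ Ioo 0 r, g s < 0) : radialAvg k g r < 0 := by
  have h1 : Continuous fun t : ℝ => t ^ k * -g (r * t) := by fun_prop
  have h2 := intervalIntegral.intervalIntegral_pos_of_pos_on (h1.intervalIntegrable 0 1)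
    (fun t ht => mul_pos (pow_pos ht.1 k) (neg_pos.2 (h (r * t)
      ⟨mul_pos hr ht.1, mul_lt_of_lt_one_right hr ht.2⟩))) zero_lt_one
  simp only [mul_neg, intervalIntegral.integral_neg] at h2
  exact neg_pos.1 h2

/-- If `g ≤ 0` on `(0, ∞)` and `g ≤ -ε` on `[1, ∞)`, the averages stay away from zero. -/
theorem exists_radialAvg_le (k : ℕ) {g : ℝ → ℝ} (hg : Continuous g) {ε : ℝ} (hε : 0 < ε)
    (h0 : ∀ s, 0 < s → g s ≤ 0) (h : ∀ s, 1 ≤ s → g s ≤ -ε) :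
    ∃ δ > 0, ∀ r, 2 ≤ r → radialAvg k g r ≤ -δ := by
  refine ⟨(1 / 2) ^ k * ε / 2, by positivity, fun r hr => ?_⟩
  have hc : Continuous fun t : ℝ => t ^ k * g (r * t) := by fun_prop
  have h1 : radialAvg k g r = (∫ t in (0:ℝ)..(1 / 2), t ^ k * g (r * t)) +
      ∫ t in (1 / 2 : ℝ)..1, t ^ k * g (r * t) :=
    (intervalIntegral.integral_add_adjacent_intervals (hc.intervalIntegrable _ _)
      (hc.intervalIntegrable _ _)).symm
  have h2 : ∫ t in (0:ℝ)..(1 / 2), t ^ k * g (r * t) ≤ ∫ _t in (0:ℝ)..(1 / 2), (0:ℝ) := by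
    apply intervalIntegral.integral_mono_on_of_le_Ioo (by norm_num) (hc.intervalIntegrable _ _)
      (by simp)
    intro t ht
    exact mul_nonpos_of_nonneg_of_nonpos (pow_nonneg ht.1.le k)
      (h0 _ (mul_pos (by linarith) ht.1))
  have h3 : ∫ t in (1 / 2 : ℝ)..1, t ^ k * g (r * t) ≤
      ∫ _t in (1 / 2 : ℝ)..1, -((1 / 2) ^ k * ε) := by
    apply intervalIntegral.integral_mono_on (by norm_num) (hc.intervalIntegrable _ _) (by simp)
    intro t ht
    have h4 : g (r * t) ≤ -ε := h _ (by nlinarith [ht.1])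
    have h5 : (1 / 2 : ℝ) ^ k ≤ t ^ k := pow_le_pow_left₀ (by norm_num) ht.1 k
    have : (1 / 2 : ℝ) ^ k * ε ≤ t ^ k * (-g (r * t)) :=
      mul_le_mul h5 (by linarith) hε.le (pow_nonneg (by linarith [ht.1]) k)
    linarith
  simp only [intervalIntegral.integral_const, smul_eq_mul] at h2 h3
  rw [h1]
  linarith

theorem exists_radial_system (k : ℕ) (G φ : ℝ × ℝ × ℝ → ℝ) {K₁ K₂ : NNReal}
    (hG : LipschitzWith K₁ G) (hφ : LipschitzWith K₂ φ) :
    ∃ Q p I : ℝ → ℝ, Q 0 = 1 ∧ p 0 = 0 ∧ I 0 = 0 ∧ (∀ r, HasDerivAt Q (p r) r) ∧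
      (∀ r, HasDerivAt I (φ (Q r, p r, I r)) r) ∧ Continuous p ∧
      ∀ r, p r = r * radialAvg k (fun s => G (Q s, p s, I s)) r := by
  let H : ℝ → ℝ × ℝ × ℝ → ℝ × ℝ × ℝ := fun t x => (x.2.1, t ^ k * G x, φ x)
  have hH : Continuous (Function.uncurry H) := by
    have := hG.continuous
    have := hφ.continuous
    unfold Function.uncurry
    fun_prop
  obtain ⟨X, hXc, hX⟩ := exists_continuous_volterra H hH (L := 1 + K₁ + K₂) (by positivity) (by
    intro t ht x y
    have h1 := hG.dist_le_mul x y
    have h2 := hφ.dist_le_mul x y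
    rw [dist_eq_norm, dist_eq_norm] at h1 h2
    have h3 : ‖x.2.1 - y.2.1‖ ≤ ‖x - y‖ := (norm_fst_le (x - y).2).trans (norm_snd_le (x - y))
    have h0 := norm_nonneg (x - y)
    have hk1 : (0:ℝ) ≤ K₁ * ‖x - y‖ := by positivity
    have hk2 : (0:ℝ) ≤ K₂ * ‖x - y‖ := by positivity
    have h4 : ‖t ^ k * G x - t ^ k * G y‖ ≤ ‖G x - G y‖ := by
      rw [← mul_sub, norm_mul, norm_pow, Real.norm_of_nonneg ht.1]
      exact mul_le_of_le_one_left (norm_nonneg _) (pow_le_one₀ ht.1 ht.2)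
    simp only [H, Prod.mk_sub_mk, Prod.norm_mk]
    refine max_le (by nlinarith) (max_le (by nlinarith) (by nlinarith))) (1, 0, 0)
  have hGc : Continuous fun s => G (X s) := hG.continuous.comp hXc
  have hφc : Continuous fun s => φ (X s) := hφ.continuous.comp hXc
  have hint : ∀ r, ∫ t in (0:ℝ)..1, H t (X (r * t)) =
      (∫ t in (0:ℝ)..1, (X (r * t)).2.1, radialAvg k (fun s => G (X s)) r,
        ∫ t in (0:ℝ)..1, φ (X (r * t))) := by
    intro r
    have hc : Continuous fun t => H t (X (r * t)) :=
      hH.comp (by fun_prop : Continuous fun t : ℝ => (t, X (r * t)))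
    have hi := hc.intervalIntegrable (μ := MeasureTheory.volume) 0 1
    have e1 := (ContinuousLinearMap.fst ℝ ℝ (ℝ × ℝ)).intervalIntegral_comp_comm hi
    have e2 := ((ContinuousLinearMap.fst ℝ ℝ ℝ).comp
      (ContinuousLinearMap.snd ℝ ℝ (ℝ × ℝ))).intervalIntegral_comp_comm hi
    have e3 := ((ContinuousLinearMap.snd ℝ ℝ ℝ).comp
      (ContinuousLinearMap.snd ℝ ℝ (ℝ × ℝ))).intervalIntegral_comp_comm hi
    refine Prod.ext e1.symm (Prod.ext e2.symm e3.symm)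
  have hQ : ∀ r, (X r).1 = 1 + ∫ s in (0:ℝ)..r, (X s).2.1 := by
    intro r
    have := congrArg Prod.fst (hX r)
    rw [hint] at this
    simp only [Prod.fst_add, Prod.smul_fst, smul_eq_mul] at this
    rw [this, intervalIntegral.mul_integral_comp_mul_left (f := fun s => (X s).2.1)]
    simp
  have hI : ∀ r, (X r).2.2 = ∫ s in (0:ℝ)..r, φ (X s) := by
    intro r
    have := congrArg (fun x => x.2.2) (hX r)
    rw [hint] at this
    simp only [Prod.snd_add, Prod.smul_snd, smul_eq_mul, zero_add] at this
    rw [this, intervalIntegral.mul_integral_comp_mul_left (f := fun s => φ (X s))]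
    simp
  have hp : ∀ r, (X r).2.1 = r * radialAvg k (fun s => G (X s)) r := by
    intro r
    have := congrArg (fun x => x.2.1) (hX r)
    rw [hint] at this
    simpa using this
  have hpc : Continuous fun s => (X s).2.1 := by fun_prop
  refine ⟨fun r => (X r).1, fun r => (X r).2.1, fun r => (X r).2.2, by simp [hQ], by simp [hp],
    by simp [hI], fun r => ?_, fun r => ?_, hpc, hp⟩
  · have := (hpc.integral_hasStrictDerivAt 0 r).hasDerivAt.const_add 1
    exact this.congr_of_eventuallyEq (Eventually.of_forall hQ)
  · exact (hφc.integral_hasStrictDerivAt 0 r).hasDerivAt.congr_of_eventuallyEq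
      (Eventually.of_forall hI)

/-- Extending a Lipschitz function on a box by clamping its arguments. -/
theorem lipschitzWith_clamp_box {f : ℝ × ℝ → ℝ} {a b a' b' : ℝ} (hab : a ≤ b) (hab' : a' ≤ b')
    (hf : ContDiffOn ℝ 1 f (Icc a b ×ˢ Icc a' b')) :
    ∃ K : NNReal, LipschitzWith K fun x : ℝ × ℝ × ℝ =>
      f (projIcc a b hab x.1, projIcc a' b' hab' x.2.1) := by
  obtain ⟨K, hK⟩ := hf.exists_lipschitzOnWith one_ne_zero
    ((convex_Icc a b).prod (convex_Icc a' b')) (isCompact_Icc.prod isCompact_Icc)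
  refine ⟨K, LipschitzWith.of_dist_le_mul fun x y => ?_⟩
  refine (hK.dist_le_mul _ ⟨Subtype.prop _, Subtype.prop _⟩ _
    ⟨Subtype.prop _, Subtype.prop _⟩).trans ?_
  gcongr
  rw [Prod.dist_eq]
  refine max_le ?_ ?_
  · refine ((LipschitzWith.projIcc hab).dist_le_mul x.1 y.1).trans ?_
    rw [NNReal.coe_one, one_mul, Prod.dist_eq]
    exact le_max_left _ _
  · refine ((LipschitzWith.projIcc hab').dist_le_mul x.2.1 y.2.1).trans ?_
    rw [NNReal.coe_one, one_mul, Prod.dist_eq (x := x), Prod.dist_eq (x := x.2)]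
    exact (le_max_left _ _).trans (le_max_right _ _)

theorem hasDerivAt_integral_of_continuousOn_Ioi {f : ℝ → ℝ} (hf : ContinuousOn f (Ioi 0)) {q : ℝ}
    (hq : 0 < q) : HasDerivAt (fun u => ∫ s in (1:ℝ)..u, f s) (f q) q := by
  have hsub : uIcc 1 q ⊆ Ioi 0 := fun x hx => (lt_min one_pos hq).trans_le hx.1
  exact intervalIntegral.integral_hasDerivAt_right (hf.mono hsub).intervalIntegrable
    (hf.stronglyMeasurableAtFilter isOpen_Ioi q hq) (hf.continuousAt (Ioi_mem_nhds hq))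

section Potentials

variable (d n c μ : ℝ)

theorem continuousOn_rpow_const_Ioi (a : ℝ) : ContinuousOn (fun q : ℝ => q ^ a) (Ioi 0) :=
  fun _ hq => (Real.continuousAt_rpow_const _ _ (Or.inl (ne_of_gt hq))).continuousWithinAt

theorem hasDerivAt_F1 (hn : n ≠ 1) {q : ℝ} (hq : 0 < q) :
    HasDerivAt (fun q => F1 d n c q μ) (q ^ (-n) - n / c / q) q := by
  have h1 := ((Real.hasDerivAt_rpow_const (p := 1 - n) (Or.inl hq.ne')).sub_const 1).const_mul
    (-(1 / (n - 1)))
  have h2 := (Real.hasDerivAt_log hq.ne').const_mul (n / c)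
  refine ((h1.sub h2).add_const (μ * d)).congr_deriv ?_
  have : n - 1 ≠ 0 := sub_ne_zero.2 hn
  rw [show 1 - n - 1 = -n by ring]
  field_simp
  ring

theorem F1_one : F1 d n c 1 μ = μ * d := by simp [F1]

theorem F2_one : F2 d n c 1 μ = 0 := by simp [F2]

theorem F3_one : F3 d n c 1 μ = μ * d := by simp [F3, F1_one]

theorem continuousOn_F1 : ContinuousOn (fun q => F1 d n c q μ) (Ioi 0) := by
  unfold F1
  refine ContinuousOn.add (ContinuousOn.sub (ContinuousOn.mul continuousOn_const
    ((continuousOn_rpow_const_Ioi _).sub continuousOn_const)) (ContinuousOn.mul continuousOn_const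
    (Real.continuousOn_log.mono fun q hq => ne_of_gt hq))) continuousOn_const

theorem continuousOn_F1_mul : ContinuousOn (fun q => F1 d n c q μ * q ^ n) (Ioi 0) :=
  (continuousOn_F1 d n c μ).mul (continuousOn_rpow_const_Ioi _)

theorem hasDerivAt_F2 {q : ℝ} (hq : 0 < q) :
    HasDerivAt (fun q => F2 d n c q μ) (F1 d n c q μ * q ^ n) q :=
  hasDerivAt_integral_of_continuousOn_Ioi (continuousOn_F1_mul d n c μ) hq

theorem continuousOn_F2 : ContinuousOn (fun q => F2 d n c q μ) (Ioi 0) :=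
  fun _ hq => (hasDerivAt_F2 d n c μ hq).continuousAt.continuousWithinAt

theorem continuousOn_F2_mul : ContinuousOn (fun q => F2 d n c q μ * q ^ (-(n + 2))) (Ioi 0) :=
  (continuousOn_F2 d n c μ).mul (continuousOn_rpow_const_Ioi _)

theorem hasDerivAt_integral_F2 {q : ℝ} (hq : 0 < q) :
    HasDerivAt (fun u => ∫ q in (1:ℝ)..u, F2 d n c q μ * q ^ (-(n + 2)))
      (F2 d n c q μ * q ^ (-(n + 2))) q :=
  hasDerivAt_integral_of_continuousOn_Ioi (continuousOn_F2_mul d n c μ) hq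

theorem continuousOn_F3 : ContinuousOn (fun q => F3 d n c q μ) (Ioi 0) :=
  (continuousOn_F1 d n c μ).sub (continuousOn_const.mul fun _ hq =>
    (hasDerivAt_integral_F2 d n c μ hq).continuousAt.continuousWithinAt)

theorem F1_affine (q : ℝ) :
    F1 d n c q μ = F1 d n c q 0 + (F1 d n c q 1 - F1 d n c q 0) * μ := by
  simp only [F1]; ring

theorem integral_affine {f g h : ℝ → ℝ} (hf : ContinuousOn f (Ioi 0)) (hg : ContinuousOn g (Ioi 0))
    {q : ℝ} (hq : 0 < q) (e : ∀ s, 0 < s → h s = f s + (g s - f s) * μ) :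
    ∫ s in (1:ℝ)..q, h s = (∫ s in (1:ℝ)..q, f s) +
      ((∫ s in (1:ℝ)..q, g s) - ∫ s in (1:ℝ)..q, f s) * μ := by
  have hsub : uIcc 1 q ⊆ Ioi 0 := fun x hx => (lt_min one_pos hq).trans_le hx.1
  have hfi := (hf.mono hsub).intervalIntegrable (μ := MeasureTheory.volume)
  have hgi := (hg.mono hsub).intervalIntegrable (μ := MeasureTheory.volume)
  rw [← intervalIntegral.integral_sub hgi hfi, ← intervalIntegral.integral_mul_const,
    ← intervalIntegral.integral_add hfi ((hgi.sub hfi).mul_const μ)]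
  exact intervalIntegral.integral_congr fun s hs => e s (hsub hs)

theorem F2_affine {q : ℝ} (hq : 0 < q) :
    F2 d n c q μ = F2 d n c q 0 + (F2 d n c q 1 - F2 d n c q 0) * μ :=
  integral_affine μ (continuousOn_F1_mul d n c 0) (continuousOn_F1_mul d n c 1) hq
    fun s _ => by rw [F1_affine]; ring

theorem F3_affine {q : ℝ} (hq : 0 < q) :
    F3 d n c q μ = F3 d n c q 0 + (F3 d n c q 1 - F3 d n c q 0) * μ := by
  have := integral_affine μ (h := fun q => F2 d n c q μ * q ^ (-(n + 2)))
    (continuousOn_F2_mul d n c 0) (continuousOn_F2_mul d n c 1) hq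
    fun s hs => by rw [F2_affine d n c μ hs]; ring
  simp only [F3]
  rw [this, F1_affine]
  ring

end Potentials

/-- Below the minimum of `mu3`, the function `F3` is nonpositive on `[Qs, 1]`. -/
theorem F3_nonpos {d n c Qs m : ℝ} (hd : 0 < d) (hQs : Qs ∈ Ioo (0:ℝ) 1)
    (hQsu : ∀ q ∈ Ioo (0:ℝ) 1, F3 d n c q 1 - F3 d n c q 0 = 0 → q = Qs)
    (hmin : ∀ q ∈ Ioo Qs (1:ℝ), m ≤ mu3 d n c q) {μ : ℝ} (hμ : μ ≤ m) {q : ℝ}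
    (hq : q ∈ Icc Qs 1) : F3 d n c q μ ≤ 0 := by
  have hpos : ∀ q ∈ Ioo Qs (1:ℝ), 0 < F3 d n c q 1 - F3 d n c q 0 := by
    intro q hq
    by_contra! hle
    have hcont : ContinuousOn (fun q => F3 d n c q 1 - F3 d n c q 0) (Icc q 1) :=
      ((continuousOn_F3 d n c 1).sub (continuousOn_F3 d n c 0)).mono
        fun x hx => (hQs.1.trans hq.1).trans_le hx.1
    have h1 : F3 d n c 1 1 - F3 d n c 1 0 = d := by simp [F3_one]
    obtain ⟨x, hx, hx0⟩ := intermediate_value_Icc hq.2.le hcont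
      (show (0:ℝ) ∈ Icc _ _ from ⟨hle, by rw [h1]; exact hd.le⟩)
    have hx1 : x ≠ 1 := by
      rintro rfl
      exact hd.ne' (h1.symm.trans hx0)
    have := hQsu x ⟨(hQs.1.trans hq.1).trans_le hx.1, lt_of_le_of_ne hx.2 hx1⟩ hx0
    linarith [hx.1, hq.1]
  have hIoo : ∀ q ∈ Ioo Qs (1:ℝ), F3 d n c q μ ≤ 0 := by
    intro q hq
    have hh := hpos q hq
    have h1 := hμ.trans (hmin q hq)
    rw [mu3, le_div_iff₀ hh] at h1
    rw [F3_affine d n c μ (hQs.1.trans hq.1)]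
    linarith
  have hcl : closure (Ioo Qs 1) = Icc Qs 1 := closure_Ioo hQs.2.ne
  rw [← hcl] at hq
  refine le_on_closure hIoo ?_ continuousOn_const hq
  rw [hcl]
  exact (continuousOn_F3 d n c μ).mono fun x hx => hQs.1.trans_le hx.1

/-- Profiles solving the integrated first-order system solve the initial value problem. -/
theorem isIVPSolutionOn_of_system {d n c μ σ : ℝ} (k : ℕ) (hd : d = k + 1) (hn : n ≠ 1)
    {Q p I g : ℝ → ℝ} {U : Set ℝ} (hU : IsOpen U) (hσU : Icc 0 σ ⊆ U) (h0U : 0 ∈ U)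
    (hg : Continuous g) (hQ0 : Q 0 = 1) (hI0 : I 0 = 0) (hQ : ∀ r, HasDerivAt Q (p r) r)
    (hp : ∀ r, p r = r * radialAvg k g r)
    (hI : ∀ r ∈ U, HasDerivAt I (p r ^ 3 / (2 * Q r ^ 2)) r) (hQU : ∀ r ∈ U, 0 < Q r)
    (hgU : ∀ r ∈ U, g r = F1 d n c (Q r) μ - n * p r ^ 2 / (2 * Q r) - n * I r) :
    isIVPSolutionOn d n c μ Q σ := by
  have hd0 : (k:ℝ) + 1 ≠ 0 := by positivity
  set v := radialAvg k g with hv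
  set a : ℝ → ℝ := fun r => g r - k * v r with ha
  have hvc : Continuous v := continuous_radialAvg k hg
  have hpa : ∀ r, HasDerivAt p (a r) r := fun r =>
    (hasDerivAt_mul_radialAvg k hg r).congr_of_eventuallyEq (Eventually.of_forall hp)
  have hpc : Continuous p := continuous_iff_continuousAt.2 fun r => (hpa r).continuousAt
  have hQc : Continuous Q := continuous_iff_continuousAt.2 fun r => (hQ r).continuousAt
  have hp0 : p 0 = 0 := by rw [hp, zero_mul]
  set g' : ℝ → ℝ := fun r =>
    p r * (Q r ^ (-n) - n / c / Q r) - n * p r * a r / Q r with hg'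
  have hgd : ∀ r ∈ U, HasDerivAt g (g' r) r := by
    intro r hr
    have hq := hQU r hr
    have h1 := (hasDerivAt_F1 d n c μ hn hq).comp r (hQ r)
    have h2 := (((hpa r).pow 2).const_mul n).div ((hQ r).const_mul 2)
      (mul_ne_zero two_ne_zero hq.ne')
    have h3 := (h1.sub h2).sub ((hI r hr).const_mul n)
    refine (h3.congr_of_eventuallyEq ?_).congr_deriv ?_
    · filter_upwards [hU.mem_nhds hr] with s hs using hgU s hs
    · simp only [hg', Pi.pow_apply]
      field_simp
      ring
  set w : ℝ → ℝ := fun r => (g r - (k + 1) * v r) / r with hw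
  have hg0 : HasDerivAt g 0 0 := by simpa [hg', hp0] using hgd 0 h0U
  have hv0 : HasDerivAt v 0 0 := hasDerivAt_radialAvg_zero k hg hg0
  have hvd : ∀ r, HasDerivAt v (w r) r := by
    intro r
    by_cases hr : r = 0
    · subst hr; simpa [hw] using hv0
    · exact hasDerivAt_radialAvg k hg hr
  have hwc : Continuous w := by
    refine continuous_iff_continuousAt.2 fun r => ?_
    by_cases hr : r = 0
    · subst hr
      have h1 : HasDerivAt (fun r => g r - (k + 1) * v r) 0 0 := by
        refine (hg0.sub (hv0.const_mul ((k:ℝ) + 1))).congr_deriv ?_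
        simp
      have h2 : g 0 - (k + 1) * v 0 = 0 := by
        rw [hv, radialAvg_zero]; field_simp; ring
      rw [continuousAt_iff_punctured_nhds]
      rw [hasDerivAt_iff_tendsto_slope] at h1
      have h3 : w 0 = 0 := by simp [hw]
      rw [h3]
      refine h1.congr fun u => ?_
      simp only [slope_def_field, h2, hw, sub_zero]
    · exact (by fun_prop : Continuous fun r => g r - (k + 1) * v r).continuousAt.div
        continuousAt_id hr
  have hac : Continuous a := by fun_prop
  have had : ∀ r ∈ U, HasDerivAt a (g' r - k * w r) r := fun r hr =>
    (hgd r hr).sub ((hvd r).const_mul _)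
  have hg'c : ContinuousOn g' U := by
    have hne : ∀ r ∈ U, Q r ≠ 0 := fun r hr => (hQU r hr).ne'
    refine ((hpc.continuousOn).mul ((hQc.continuousOn.rpow_const fun r hr => Or.inl (hne r hr)).sub
      (continuousOn_const.div hQc.continuousOn hne))).sub
      (ContinuousOn.div (by fun_prop) hQc.continuousOn hne)
  have hdQ : deriv Q = p := funext fun r => (hQ r).deriv
  have hdp : deriv p = a := funext fun r => (hpa r).deriv
  have hCa : ContDiffOn ℝ 1 a U := by
    rw [show (1 : WithTop ℕ∞) = 0 + 1 by norm_num, contDiffOn_succ_iff_deriv_of_isOpen hU]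
    refine ⟨fun r hr => (had r hr).differentiableAt.differentiableWithinAt, by simp, ?_⟩
    rw [contDiffOn_zero]
    exact (hg'c.sub (continuousOn_const.mul hwc.continuousOn)).congr fun r hr => (had r hr).deriv
  have hCp : ContDiffOn ℝ 2 p U := by
    rw [show (2 : WithTop ℕ∞) = 1 + 1 by norm_num, contDiffOn_succ_iff_deriv_of_isOpen hU, hdp]
    exact ⟨fun r hr => (hpa r).differentiableAt.differentiableWithinAt, by simp, hCa⟩
  have hCQ : ContDiffOn ℝ 3 Q U := by
    rw [show (3 : WithTop ℕ∞) = 2 + 1 by norm_num, contDiffOn_succ_iff_deriv_of_isOpen hU, hdQ]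
    exact ⟨fun r hr => (hQ r).differentiableAt.differentiableWithinAt, by simp, hCp⟩
  refine ⟨hCQ.mono hσU, fun r hr => ?_, hQ0, by rw [hdQ, hp0], ?_⟩
  · have hrU : r ∈ U := hσU ⟨hr.1.le, hr.2.le⟩
    have hq := hQU r hrU
    have hr0 : r ≠ 0 := hr.1.ne'
    have hQn : HasDerivAt (fun s => Q s ^ n) (p r * n * Q r ^ (n - 1)) r :=
      (hQ r).rpow_const (Or.inl hq.ne')
    have e1 : deriv (fun s => p s / s) r = w r := by
      refine ((hvd r).congr_of_eventuallyEq ?_).deriv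
      filter_upwards [isOpen_ne.mem_nhds hr0] with s hs
      rw [hp, mul_div_cancel_left₀ _ hs]
    have e0 : deriv (fun s => Q s ^ n * a s) r =
        p r * n * Q r ^ (n - 1) * a r + Q r ^ n * (g' r - k * w r) :=
      (hQn.mul (had r hrU)).deriv
    unfold magmaODE
    rw [hdQ, hdp, e1, hQn.deriv, e0, hd]
    have e2 : Q r ^ (n - 1) = Q r ^ n / Q r := Real.rpow_sub_one hq.ne' n
    have e3 : Q r ^ (-n) = (Q r ^ n)⁻¹ := Real.rpow_neg hq.le n
    have hQn0 : Q r ^ n ≠ 0 := (Real.rpow_pos_of_pos hq n).ne'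
    simp only [hg']
    rw [e2, e3]
    by_cases hc : c = 0
    · subst hc
      simp
      field_simp
      ring
    · field_simp
      ring
  · rw [hdQ, hdp]
    simp only [ha, hv]
    rw [radialAvg_zero, hgU 0 h0U, hQ0, hp0, hI0, F1_one, hd]
    field_simp
    ring

/-- Energy estimates along a decreasing profile trapped in `[Qs, 1]`. -/
theorem trapped_estimates {d n c μ Qs T : ℝ} (k : ℕ) (hn : 0 < n) (hT : 0 < T)
    (hQs : 0 < Qs) {Q p I g : ℝ → ℝ} (hg : Continuous g) (hQ0 : Q 0 = 1) (hI0 : I 0 = 0)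
    (hQ : ∀ r, HasDerivAt Q (p r) r) (hp : ∀ r, p r = r * radialAvg k g r)
    (hI : ∀ r ∈ Icc 0 T, HasDerivAt I (p r ^ 3 / (2 * Q r ^ 2)) r)
    (hgT : ∀ r ∈ Icc 0 T, g r = F1 d n c (Q r) μ - n * p r ^ 2 / (2 * Q r) - n * I r)
    (hQT : ∀ r ∈ Icc 0 T, Q r ∈ Icc Qs 1) (hpT : ∀ r ∈ Ioo 0 T, p r < 0)
    (hF3 : ∀ q ∈ Icc Qs 1, F3 d n c q μ ≤ 0) {J : ℝ → ℝ}
    (hJ : J = fun r => n * (I r - ∫ q in (1:ℝ)..Q r, F2 d n c q μ * q ^ (-(n + 2)))) :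
    Q T ^ n * p T ^ 2 / 2 ≤ F2 d n c (Q T) μ ∧ StrictMonoOn J (Icc 0 T) ∧
      ∀ r ∈ Icc 0 T, g r ≤ -J r := by
  have hpos : ∀ r ∈ Icc 0 T, 0 < Q r := fun r hr => hQs.trans_le (hQT r hr).1
  have hsub : ∀ r ∈ interior (Icc 0 T), r ∈ Icc 0 T ∧ r ∈ Ioo 0 T := by
    intro r hr
    rw [interior_Icc] at hr
    exact ⟨Ioo_subset_Icc_self hr, hr⟩
  have hp0 : p 0 = 0 := by rw [hp, zero_mul]
  have hpa : ∀ r, HasDerivAt p (g r - k * radialAvg k g r) r := fun r =>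
    (hasDerivAt_mul_radialAvg k hg r).congr_of_eventuallyEq (Eventually.of_forall hp)
  have hIanti : StrictAntiOn I (Icc 0 T) := by
    refine strictAntiOn_of_deriv_neg (convex_Icc 0 T)
      (fun r hr => (hI r hr).continuousAt.continuousWithinAt) fun r hr => ?_
    obtain ⟨h1, h2⟩ := hsub r hr
    rw [(hI r h1).deriv]
    have := hpos r h1
    exact div_neg_of_neg_of_pos (Odd.pow_neg (by decide) (hpT r h2)) (by positivity)
  have h0T : (0:ℝ) ∈ Icc 0 T := ⟨le_rfl, hT.le⟩
  let E : ℝ → ℝ := fun r => F2 d n c (Q r) μ - Q r ^ n * p r ^ 2 / 2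
  have hE : ∀ r ∈ Icc 0 T,
      HasDerivAt E (Q r ^ n * p r * (n * I r + k * radialAvg k g r)) r := by
    intro r hr
    have hq := hpos r hr
    have h1 := (hasDerivAt_F2 d n c μ hq).comp r (hQ r)
    have h2 : HasDerivAt (fun s => Q s ^ n) (p r * n * Q r ^ (n - 1)) r :=
      (hQ r).rpow_const (Or.inl hq.ne')
    have h3 := ((h2.mul ((hpa r).pow 2)).div_const 2)
    refine (h1.sub h3).congr_deriv ?_
    simp only [Pi.pow_apply]
    rw [hgT r hr, Real.rpow_sub_one hq.ne']
    field_simp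
    ring
  have hEmono : StrictMonoOn E (Icc 0 T) := by
    refine strictMonoOn_of_deriv_pos (convex_Icc 0 T)
      (fun r hr => (hE r hr).continuousAt.continuousWithinAt) fun r hr => ?_
    obtain ⟨h1, h2⟩ := hsub r hr
    rw [(hE r h1).deriv]
    have hIr : I r < 0 := hI0 ▸ hIanti h0T h1 h2.1
    have hvr : radialAvg k g r < 0 := by
      have := hpT r h2
      rw [hp] at this
      exact (pos_iff_neg_of_mul_neg this).1 h2.1
    refine mul_pos_of_neg_of_neg
      (mul_neg_of_pos_of_neg (Real.rpow_pos_of_pos (hpos r h1) n) (hpT r h2)) ?_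
    have h3 : n * I r < 0 := mul_neg_of_pos_of_neg hn hIr
    have h4 : k * radialAvg k g r ≤ 0 :=
      mul_nonpos_of_nonneg_of_nonpos (Nat.cast_nonneg k) hvr.le
    linarith
  have hE0 : E 0 = 0 := by simp [E, hQ0, hp0, F2_one]
  have hJd : ∀ r ∈ Icc 0 T, HasDerivAt J (n * (-p r) * Q r ^ (-(n + 2)) * E r) r := by
    intro r hr
    have hq := hpos r hr
    have h1 := (hasDerivAt_integral_F2 d n c μ hq).comp r (hQ r)
    rw [hJ]
    refine (((hI r hr).sub h1).const_mul n).congr_deriv ?_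
    have e1 : Q r ^ (-(n + 2)) = (Q r ^ n * Q r ^ 2)⁻¹ := by
      rw [Real.rpow_neg hq.le, Real.rpow_add hq, Real.rpow_two]
    have : Q r ^ n ≠ 0 := (Real.rpow_pos_of_pos hq n).ne'
    simp only [E]
    rw [e1]
    field_simp
    ring
  refine ⟨?_, ?_, fun r hr => ?_⟩
  · have := hEmono h0T ⟨hT.le, le_rfl⟩ hT
    rw [hE0] at this
    exact (sub_pos.1 this).le
  · refine strictMonoOn_of_deriv_pos (convex_Icc 0 T)
      (fun r hr => (hJd r hr).continuousAt.continuousWithinAt) fun r hr => ?_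
    obtain ⟨h1, h2⟩ := hsub r hr
    rw [(hJd r h1).deriv]
    have hEr : 0 < E r := hE0 ▸ hEmono h0T h1 h2.1
    have := neg_pos.2 (hpT r h2)
    have := Real.rpow_pos_of_pos (hpos r h1) (-(n + 2))
    positivity
  · have h1 := hF3 _ (hQT r hr)
    have h2 : 0 ≤ n * p r ^ 2 / (2 * Q r) := by have := hpos r hr; positivity
    rw [hgT r hr, hJ]
    simp only [F3] at h1
    linarith

theorem contDiffOn_F1_sub {d n c μ a b a' b' : ℝ} (ha : 0 < a) :
    ContDiffOn ℝ 1 (fun x : ℝ × ℝ => F1 d n c x.1 μ - n * x.2 ^ 2 / (2 * x.1))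
      (Icc a b ×ˢ Icc a' b') := by
  have hne : ∀ x ∈ Icc a b ×ˢ Icc a' b', x.1 ≠ 0 := fun x hx => (ha.trans_le hx.1.1).ne'
  have h1 : ContDiffOn ℝ 1 (fun x : ℝ × ℝ => x.1) (Icc a b ×ˢ Icc a' b') := contDiffOn_fst
  unfold F1
  refine ContDiffOn.sub (ContDiffOn.add (ContDiffOn.sub (contDiffOn_const.mul
    ((h1.rpow_const_of_ne hne).sub contDiffOn_const)) (contDiffOn_const.mul (h1.log hne)))
    contDiffOn_const) (ContDiffOn.div ?_ (contDiffOn_const.mul h1)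
      fun x hx => mul_ne_zero two_ne_zero (hne x hx))
  exact contDiffOn_const.mul (contDiffOn_snd.pow 2)

theorem contDiffOn_cube_div {a b a' b' : ℝ} (ha : 0 < a) :
    ContDiffOn ℝ 1 (fun x : ℝ × ℝ => x.2 ^ 3 / (2 * x.1 ^ 2)) (Icc a b ×ˢ Icc a' b') :=
  (contDiffOn_snd.pow 3).div (contDiffOn_const.mul (contDiffOn_fst.pow 2)) fun _ hx =>
    mul_ne_zero two_ne_zero (pow_ne_zero 2 (ha.trans_le hx.1.1).ne')

/-- A profile solving the integrated system with `Q` clamped to `[a, 2]` and `p` to `[-B, B]`. -/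
theorem exists_clamped_profile (k : ℕ) {d n c μ a B : ℝ} (ha : 0 < a) (ha2 : a ≤ 2)
    (hB : 0 ≤ B) : ∃ Q p I g : ℝ → ℝ, Continuous g ∧ Q 0 = 1 ∧ I 0 = 0 ∧
      (∀ r, HasDerivAt Q (p r) r) ∧ (∀ r, p r = r * radialAvg k g r) ∧ Continuous p ∧
      (∀ r, Q r ∈ Icc a 2 → p r ∈ Icc (-B) B → HasDerivAt I (p r ^ 3 / (2 * Q r ^ 2)) r) ∧
      ∀ r, Q r ∈ Icc a 2 → p r ∈ Icc (-B) B →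
        g r = F1 d n c (Q r) μ - n * p r ^ 2 / (2 * Q r) - n * I r := by
  have hBB : -B ≤ B := by linarith
  obtain ⟨K₁, hK₁⟩ := lipschitzWith_clamp_box ha2 hBB
    (contDiffOn_F1_sub (d := d) (n := n) (c := c) (μ := μ) ha)
  obtain ⟨K₂, hK₂⟩ := lipschitzWith_clamp_box ha2 hBB (contDiffOn_cube_div ha)
  have hK₃ := (n • (ContinuousLinearMap.snd ℝ ℝ ℝ).comp
    (ContinuousLinearMap.snd ℝ ℝ (ℝ × ℝ))).lipschitz
  obtain ⟨Q, p, I, hQ0, -, hI0, hQ, hI, hpc, hp⟩ := exists_radial_system k _ _ (hK₁.sub hK₃) hK₂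
  have hQc : Continuous Q := continuous_iff_continuousAt.2 fun r => (hQ r).continuousAt
  have hIc : Continuous I := continuous_iff_continuousAt.2 fun r => (hI r).continuousAt
  refine ⟨Q, p, I, _, (hK₁.sub hK₃).continuous.comp (hQc.prodMk (hpc.prodMk hIc)), hQ0, hI0, hQ,
    hp, hpc, fun r h1 h2 => ?_, fun r h1 h2 => ?_⟩
  · have := hI r
    simpa only [projIcc_of_mem _ h1, projIcc_of_mem _ h2] using this
  · simp [projIcc_of_mem _ h1, projIcc_of_mem _ h2]

/-- If `F3` is nonpositive on `[Qs, 1]`, the profile decreases until it reaches `Qs`. -/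
theorem mem_setA_of_F3_nonpos {d n c Qs μ : ℝ} (k : ℕ) (hd : d = k + 1) (hn : 1 < n)
    (hQs : Qs ∈ Ioo (0:ℝ) 1) (hμ : μ < 0) (hF3 : ∀ q ∈ Icc Qs 1, F3 d n c q μ ≤ 0) :
    μ ∈ setA d n c Qs := by
  have hn0 : 0 < n := by linarith
  obtain ⟨hQs0, hQs1⟩ := hQs
  obtain ⟨M, hM⟩ : ∃ M, ∀ q ∈ Icc Qs 1, ‖2 * F2 d n c q μ / q ^ n‖ ≤ M := by
    refine isCompact_Icc.exists_bound_of_continuousOn (ContinuousOn.mono (s := Ioi 0)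
      ?_ fun x hx => hQs0.trans_le hx.1)
    exact (continuousOn_const.mul (continuousOn_F2 d n c μ)).div (continuousOn_rpow_const_Ioi n)
      fun _ hx => (Real.rpow_pos_of_pos hx n).ne'
  have hM0 : 0 ≤ M := (norm_nonneg _).trans (hM 1 ⟨hQs1.le, le_rfl⟩)
  set B := M + 1 with hBdef
  have hB : 0 < B := by linarith
  obtain ⟨Q, p, I, g, hg, hQ0, hI0, hQ, hp, hpc, hI, hgf⟩ :=
    exists_clamped_profile k (d := d) (n := n) (c := c) (μ := μ) (half_pos hQs0)
      (by linarith) hB.le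
  have hQc : Continuous Q := continuous_iff_continuousAt.2 fun r => (hQ r).continuousAt
  have hp0 : p 0 = 0 := by rw [hp, zero_mul]
  set J : ℝ → ℝ := fun r => n * (I r - ∫ q in (1:ℝ)..Q r, F2 d n c q μ * q ^ (-(n + 2))) with hJ
  have hJ0 : J 0 = 0 := by simp [hJ, hI0, hQ0]
  have key : ∀ T, 0 < T → (∀ r ∈ Ioo 0 T, Qs < Q r ∧ -B < p r ∧ p r < 0) →
      (∀ r ∈ Icc 0 T, Q r ∈ Icc Qs 1) ∧ p T < 0 ∧ -B < p T ∧ StrictMonoOn J (Icc 0 T) ∧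
        ∀ r ∈ Icc 0 T, g r ≤ -J r := by
    intro T hT hgood
    have hcl : closure (Ioo 0 T) = Icc 0 T := closure_Ioo hT.ne
    have hpB : ∀ r ∈ Icc 0 T, p r ∈ Icc (-B) B := by
      intro r hr
      rw [← hcl] at hr
      have h1 := le_on_closure (f := fun _ => -B) (g := p) (fun x hx => (hgood x hx).2.1.le)
        continuousOn_const hpc.continuousOn hr
      have h2 := le_on_closure (f := p) (g := fun _ => 0) (fun x hx => (hgood x hx).2.2.le)
        hpc.continuousOn continuousOn_const hr
      exact ⟨h1, h2.trans hB.le⟩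
    have hanti : AntitoneOn Q (Icc 0 T) := by
      refine antitoneOn_of_deriv_nonpos (convex_Icc 0 T) hQc.continuousOn
        (fun r _ => (hQ r).differentiableAt.differentiableWithinAt) fun r hr => ?_
      rw [interior_Icc] at hr
      rw [(hQ r).deriv]
      exact (hgood r hr).2.2.le
    have hQT : ∀ r ∈ Icc 0 T, Q r ∈ Icc Qs 1 := by
      intro r hr
      refine ⟨?_, hQ0 ▸ hanti ⟨le_rfl, hT.le⟩ hr hr.1⟩
      rw [← hcl] at hr
      exact le_on_closure (f := fun _ => Qs) (g := Q) (fun x hx => (hgood x hx).1.le)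
        continuousOn_const hQc.continuousOn hr
    have hbox : ∀ r ∈ Icc 0 T, Q r ∈ Icc (Qs / 2) 2 := fun r hr =>
      ⟨by linarith [(hQT r hr).1], by linarith [(hQT r hr).2]⟩
    obtain ⟨hE, hJm, hgJ⟩ := trapped_estimates k hn0 hT hQs0 hg hQ0 hI0 hQ hp
      (fun r hr => hI r (hbox r hr) (hpB r hr)) (fun r hr => hgf r (hbox r hr) (hpB r hr)) hQT
      (fun r hr => (hgood r hr).2.2) hF3 hJ
    have hTT : T ∈ Icc 0 T := ⟨hT.le, le_rfl⟩
    refine ⟨hQT, ?_, ?_, hJm, hgJ⟩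
    · rw [hp]
      refine mul_neg_of_pos_of_neg hT (radialAvg_neg k hg hT fun s hs => ?_)
      have h1 := hgJ s ⟨hs.1.le, hs.2.le⟩
      have h2 := hJm ⟨le_rfl, hT.le⟩ ⟨hs.1.le, hs.2.le⟩ hs.1
      linarith
    · have hQn : 0 < Q T ^ n := Real.rpow_pos_of_pos (hQs0.trans_le (hQT T hTT).1) n
      have h1 : p T ^ 2 ≤ 2 * F2 d n c (Q T) μ / Q T ^ n := by
        rw [le_div_iff₀ hQn]; linarith
      have h2 := h1.trans ((le_abs_self _).trans (hM _ (hQT T hTT)))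
      nlinarith
  obtain ⟨δ, hδ, hδgood⟩ : ∃ δ > 0, ∀ r ∈ Ioo 0 δ, Qs < Q r ∧ -B < p r ∧ p r < 0 := by
    have hv0 : radialAvg k g 0 < 0 := by
      rw [radialAvg_zero, hgf 0 ⟨by linarith, by linarith⟩ ⟨by linarith, by linarith⟩, hQ0, hp0,
        hI0, F1_one, hd]
      have : (k:ℝ) + 1 ≠ 0 := by positivity
      have e : (μ * ((k:ℝ) + 1) - n * 0 ^ 2 / (2 * 1) - n * 0) / (k + 1) = μ := by
        field_simp
        ring
      rwa [e]
    have e1 : ∀ᶠ r in 𝓝 (0:ℝ), Qs < Q r := hQc.continuousAt.eventually_const_lt (by rwa [hQ0])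
    have e2 : ∀ᶠ r in 𝓝 (0:ℝ), -B < p r :=
      hpc.continuousAt.eventually_const_lt (by rw [hp0]; linarith)
    have e3 : ∀ᶠ r in 𝓝 (0:ℝ), radialAvg k g r < 0 :=
      (continuous_radialAvg k hg).continuousAt.eventually_lt_const hv0
    obtain ⟨δ, hδ, h⟩ := Metric.eventually_nhds_iff.1 (e1.and (e2.and e3))
    refine ⟨δ, hδ, fun r hr => ?_⟩
    obtain ⟨h1, h2, h3⟩ := h (y := r) (by
      rw [Real.dist_eq, sub_zero, abs_of_pos hr.1]; exact hr.2)
    exact ⟨h1, h2, by rw [hp]; exact mul_neg_of_pos_of_neg hr.1 h3⟩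
  let bad : Set ℝ := {r | δ ≤ r ∧ (Q r ≤ Qs ∨ p r ≤ -B ∨ 0 ≤ p r)}
  have hbad_closed : IsClosed bad :=
    (isClosed_le continuous_const continuous_id).inter
      ((isClosed_le hQc continuous_const).union
        ((isClosed_le hpc continuous_const).union (isClosed_le continuous_const hpc)))
  have hgood_of : ∀ r, 0 < r → r ∉ bad → Qs < Q r ∧ -B < p r ∧ p r < 0 := by
    intro r hr hrb
    by_cases hrδ : r < δ
    · exact hδgood r ⟨hr, hrδ⟩
    · by_contra hcon
      refine hrb ⟨not_lt.1 hrδ, ?_⟩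
      by_contra! h
      exact hcon h
  have hbad_ne : bad.Nonempty := by
    by_contra hemp
    rw [not_nonempty_iff_eq_empty] at hemp
    have hall : ∀ r, 0 < r → Qs < Q r ∧ -B < p r ∧ p r < 0 := fun r hr =>
      hgood_of r hr (by rw [hemp]; exact notMem_empty r)
    have hk := fun (T : ℝ) (hT : 0 < T) => key T hT fun r hr => hall r hr.1
    have hJpos : ∀ T, 0 < T → 0 < J T := fun T hT =>
      hJ0 ▸ (hk T hT).2.2.2.1 ⟨le_rfl, hT.le⟩ ⟨hT.le, le_rfl⟩ hT
    have hgJ : ∀ T, 0 < T → g T ≤ -J T := fun T hT => (hk T hT).2.2.2.2 T ⟨hT.le, le_rfl⟩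
    obtain ⟨ε, hε, hv⟩ := exists_radialAvg_le k hg (hJpos 1 one_pos)
      (fun s hs => by linarith [hgJ s hs, hJpos s hs]) (fun s hs => by
        have hs0 : 0 < s := by linarith
        have := (hk s hs0).2.2.2.1.monotoneOn ⟨zero_le_one, hs⟩ ⟨hs0.le, le_rfl⟩ hs
        linarith [hgJ s hs0])
    have hanti : AntitoneOn (fun r => Q r + ε * r) (Ici 2) := by
      have hd' : ∀ r, HasDerivAt (fun r => Q r + ε * r) (p r + ε * 1) r := fun r =>
        (hQ r).add ((hasDerivAt_id r).const_mul ε)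
      refine antitoneOn_of_deriv_nonpos (convex_Ici 2)
        (fun r _ => (hd' r).continuousAt.continuousWithinAt)
        (fun r _ => (hd' r).differentiableAt.differentiableWithinAt) fun r hr => ?_
      rw [interior_Ici] at hr
      have hr : 2 < r := hr
      rw [(hd' r).deriv, hp]
      nlinarith [hv r hr.le]
    have hε' : 0 < 1 / ε := by positivity
    have hR : (2:ℝ) ≤ 2 + 1 / ε := by linarith
    have h1 : Q (2 + 1 / ε) + ε * (2 + 1 / ε) ≤ Q 2 + ε * 2 := hanti self_mem_Ici hR hR
    have h2 : ε * (2 + 1 / ε) = ε * 2 + 1 := by field_simp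
    have h3 := ((hk 2 two_pos).1 2 ⟨two_pos.le, le_rfl⟩).2
    have h4 := (hall (2 + 1 / ε) (by linarith)).1
    linarith
  have hbdd : BddBelow bad := ⟨δ, fun r hr => hr.1⟩
  set T := sInf bad with hTdef
  have hTbad : T ∈ bad := hbad_closed.csInf_mem hbad_ne hbdd
  have hT : 0 < T := hδ.trans_le hTbad.1
  have hTgood : ∀ r ∈ Ioo 0 T, Qs < Q r ∧ -B < p r ∧ p r < 0 := fun r hr =>
    hgood_of r hr.1 fun hrb => (csInf_le hbdd hrb).not_gt hr.2
  obtain ⟨hQT, hpT, hpTB, -, -⟩ := key T hT hTgood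
  have hQTs : Q T = Qs := by
    refine le_antisymm ?_ (hQT T ⟨hT.le, le_rfl⟩).1
    rcases hTbad.2 with h | h | h
    · exact h
    · exact absurd h hpTB.not_ge
    · exact absurd h hpT.not_ge
  have e : ∀ᶠ r in 𝓝 T, Qs / 2 < Q r ∧ Q r < 2 ∧ -B < p r ∧ p r < 0 :=
    (hQc.continuousAt.eventually_const_lt (by linarith)).and
      ((hQc.continuousAt.eventually_lt_const (by linarith)).and
        ((hpc.continuousAt.eventually_const_lt hpTB).and
          (hpc.continuousAt.eventually_lt_const hpT)))
  obtain ⟨η, hη, he⟩ := Metric.eventually_nhds_iff.1 e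
  have hpost : ∀ r ∈ Ioc 0 (T + η / 2), Qs / 2 < Q r ∧ Q r < 2 ∧ -B < p r ∧ p r < 0 := by
    intro r hr
    by_cases hrT : r < T
    · obtain ⟨h1, h2, h3⟩ := hTgood r ⟨hr.1, hrT⟩
      exact ⟨by linarith, by linarith [(hQT r ⟨hr.1.le, hrT.le⟩).2], h2, h3⟩
    · apply he
      rw [Real.dist_eq, abs_of_nonneg (by linarith)]
      linarith [hr.2]
  let U : Set ℝ := {r | Qs / 2 < Q r ∧ Q r < 2 ∧ -B < p r ∧ p r < B}
  have hU : IsOpen U :=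
    (isOpen_lt continuous_const hQc).inter ((isOpen_lt hQc continuous_const).inter
      ((isOpen_lt continuous_const hpc).inter (isOpen_lt hpc continuous_const)))
  have h0U : (0:ℝ) ∈ U := by
    refine ⟨?_, ?_, ?_, ?_⟩ <;> simp only [hQ0, hp0] <;> linarith
  have hσU : Icc 0 (T + η / 2) ⊆ U := by
    intro r hr
    rcases hr.1.eq_or_lt with h | h
    · exact h ▸ h0U
    · obtain ⟨h1, h2, h3, h4⟩ := hpost r ⟨h, hr.2⟩
      exact ⟨h1, h2, h3, h4.trans hB⟩
  refine ⟨hμ, Q, T + η / 2, T, hT, by linarith, ?_, fun r hr => ?_, hQTs⟩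
  · exact isIVPSolutionOn_of_system k hd hn.ne' hU hσU h0U hg hQ0 hI0 hQ hp
      (fun r hr => hI r ⟨hr.1.le, hr.2.1.le⟩ ⟨hr.2.2.1.le, hr.2.2.2.le⟩)
      (fun r hr => (half_pos hQs0).trans hr.1)
      (fun r hr => hgf r ⟨hr.1.le, hr.2.1.le⟩ ⟨hr.2.2.1.le, hr.2.2.2.le⟩)
  · obtain ⟨h1, -, -, h4⟩ := hpost r hr
    exact ⟨(half_pos hQs0).trans h1, by rw [(hQ r).deriv]; exact h4⟩

/-- (−∞, μ₃(Q₃)) ⊆ A (Lemma "subset"). -/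
theorem magma_Iio_subset_setA
    (d : ℕ) (hd : 1 ≤ d) (n c Qs Q3 : ℝ)
    (hn : n ∈ Icc (2:ℝ) 3) (hc : c ∈ Ico (1.55:ℝ) n)
    (hQs : Qs ∈ Ioo (0:ℝ) 1) (hQsz : F3 (d:ℝ) n c Qs 1 - F3 (d:ℝ) n c Qs 0 = 0)
    (hQsu : ∀ q ∈ Ioo (0:ℝ) 1, F3 (d:ℝ) n c q 1 - F3 (d:ℝ) n c q 0 = 0 → q = Qs)
    (hQ3 : Q3 ∈ Ioo Qs 1)
    (hQ3min : ∀ Q ∈ Ioo Qs (1:ℝ), mu3 (d:ℝ) n c Q3 ≤ mu3 (d:ℝ) n c Q)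
    (hQ3uniq : ∀ Q ∈ Ioo Qs (1:ℝ), mu3 (d:ℝ) n c Q = mu3 (d:ℝ) n c Q3 → Q = Q3) :
    Iio (mu3 (d:ℝ) n c Q3) ⊆ setA (d:ℝ) n c Qs := by
  obtain ⟨k, rfl⟩ : ∃ k, d = k + 1 := ⟨d - 1, by omega⟩
  have hd0 : (0:ℝ) < ((k + 1 : ℕ) : ℝ) := by positivity
  intro μ hμ
  have hm : mu3 ((k + 1 : ℕ) : ℝ) n c Q3 ≤ 0 := by
    have h := F3_nonpos hd0 hQs hQsu hQ3min le_rfl (q := 1) ⟨hQs.2.le, le_rfl⟩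
    rw [F3_one] at h
    exact nonpos_of_mul_nonpos_left h hd0
  exact mem_setA_of_F3_nonpos k (by push_cast; rfl) (by linarith [hn.1]) hQs
    (lt_of_lt_of_le hμ hm) fun q hq => F3_nonpos hd0 hQs hQsu hQ3min (le_of_lt hμ) hq
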